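/- arXiv:1102.1142 — 5 statements merged into one kernel-verified Lean document; each statement's English description precedes it below -/
import Mathlib

section
/- Let G be a finite simple graph. If the family Ψ(G) of local maximum stable sets of G satisfies the accessibility property, then Ψ(G) also satisfies the exchange property, and hence (V(G), Ψ(G)) is a greedoid. -/
open Classical

variable {V : Type*} [Fintype V] [DecidableEq V]

/-- `S` is a stable (independent) set of vertices in `G`. -/
def IsStable (G : SimpleGraph V) (S : Finset V) : Prop :=
  ∀ ⦃x⦄, x ∈ S → ∀ ⦃y⦄, y ∈ S → ¬G.Adj x y

/-- The open neighborhood `N(S)`: vertices outside `S` having a neighbor in `S`. -/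
noncomputable def nbhd (G : SimpleGraph V) (S : Finset V) : Finset V :=
  Finset.univ.filter fun v => v ∉ S ∧ ∃ u ∈ S, G.Adj u v

/-- The closed neighborhood `N[S] = S ∪ N(S)`. -/
noncomputable def closedNbhd (G : SimpleGraph V) (S : Finset V) : Finset V :=
  S ∪ nbhd G S

/-- The stability (independence) number of the subgraph of `G` induced by `A`. -/
noncomputable def alphaOn (G : SimpleGraph V) (A : Finset V) : ℕ :=
  sSup {n | ∃ S ⊆ A, IsStable G S ∧ S.card = n}

/-- The stability (independence) number `α(G)`. -/
noncomputable def alpha (G : SimpleGraph V) : ℕ :=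
  alphaOn G Finset.univ

/-- `S` is a maximum stable set of the subgraph of `G` induced by `N[S]`. -/
def IsLocalMaxStable (G : SimpleGraph V) (S : Finset V) : Prop :=
  IsStable G S ∧ S.card = alphaOn G (closedNbhd G S)

/-- `Ψ(G)`: the family of all local maximum stable sets of `G`. -/
def Psi (G : SimpleGraph V) : Set (Finset V) :=
  {S | IsLocalMaxStable G S}

/-- A matching of `G`: a set of pairwise disjoint edges of `G`. -/
def IsGMatching (G : SimpleGraph V) (M : Finset (Sym2 V)) : Prop :=
  (∀ e ∈ M, e ∈ G.edgeSet) ∧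
    ∀ e ∈ M, ∀ f ∈ M, e ≠ f → ∀ v : V, v ∈ e → v ∉ f

/-- A matching of `G` all of whose edges have both endpoints inside `A`,
i.e. a matching of the subgraph of `G` induced by `A`. -/
def IsGMatchingOn (G : SimpleGraph V) (A : Finset V) (M : Finset (Sym2 V)) : Prop :=
  IsGMatching G M ∧ ∀ e ∈ M, ∀ v : V, v ∈ e → v ∈ A

/-- The matching number of the subgraph of `G` induced by `A`. -/
noncomputable def muOn (G : SimpleGraph V) (A : Finset V) : ℕ :=
  sSup {n | ∃ M, IsGMatchingOn G A M ∧ M.card = n}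

/-- The matching number `μ(G)`. -/
noncomputable def mu (G : SimpleGraph V) : ℕ :=
  muOn G Finset.univ

/-- A maximum matching of `G`. -/
def IsMaximumGMatching (G : SimpleGraph V) (M : Finset (Sym2 V)) : Prop :=
  IsGMatching G M ∧ M.card = mu G

/-- The matching `M` saturates the vertex `v`. -/
def MSaturates (M : Finset (Sym2 V)) (v : V) : Prop :=
  ∃ e ∈ M, v ∈ e

/-- A perfect matching of `G`: a matching saturating every vertex. -/
def IsPerfectGMatching (G : SimpleGraph V) (M : Finset (Sym2 V)) : Prop :=
  IsGMatching G M ∧ ∀ v : V, MSaturates M v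

/-- The set of vertices saturated by `M`. -/
noncomputable def msupp (M : Finset (Sym2 V)) : Finset V :=
  Finset.univ.filter fun v => ∃ e ∈ M, v ∈ e

/-- `M` is a uniquely restricted matching: it is the unique perfect matching of
the subgraph of `G` induced by the set of vertices saturated by `M`. -/
def UniquelyRestricted (G : SimpleGraph V) (M : Finset (Sym2 V)) : Prop :=
  IsGMatching G M ∧
    ∀ M' : Finset (Sym2 V), IsGMatchingOn G (msupp M) M' →
      (∀ v ∈ msupp M, MSaturates M' v) → M' = M

/-- Accessibility property of a set system. -/
def AccessibleFam (F : Set (Finset V)) : Prop :=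
  ∀ X ∈ F, X ≠ ∅ → ∃ x ∈ X, X.erase x ∈ F

/-- Exchange property of a set system. -/
def ExchangeFam (F : Set (Finset V)) : Prop :=
  ∀ X ∈ F, ∀ Y ∈ F, X.card = Y.card + 1 → ∃ x ∈ X, x ∉ Y ∧ insert x Y ∈ F

/-- A greedoid: a nonempty set system satisfying accessibility and exchange. -/
def IsGreedoidFam (F : Set (Finset V)) : Prop :=
  F.Nonempty ∧ AccessibleFam F ∧ ExchangeFam F

/-- A maximal stable set. -/
def IsMaximalStable (G : SimpleGraph V) (S : Finset V) : Prop :=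
  IsStable G S ∧ ∀ T, IsStable G T → S ⊆ T → S = T

/-- `G` is well-covered: all maximal stable sets have the same cardinality. -/
def WellCovered (G : SimpleGraph V) : Prop :=
  ∀ S T, IsMaximalStable G S → IsMaximalStable G T → S.card = T.card

/-- `G` is very well-covered: well-covered, no isolated vertices, `|V| = 2α(G)`. -/
def VeryWellCovered (G : SimpleGraph V) : Prop :=
  WellCovered G ∧ (∀ v : V, ∃ u, G.Adj v u) ∧ Fintype.card V = 2 * alpha G

/-- The subgraph of `G` induced by `A` is a König-Egerváry graph. -/
def KonigEgervaryOn (G : SimpleGraph V) (A : Finset V) : Prop :=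
  alphaOn G A + muOn G A = A.card

/-- `G` is a König-Egerváry graph: `α(G) + μ(G) = |V(G)|`. -/
def KonigEgervary (G : SimpleGraph V) : Prop :=
  alpha G + mu G = Fintype.card V

/-- The cycle `c` is alternating with respect to `M`: of every two incident
edges of `c` exactly one belongs to `M`. -/
def IsAlternatingCycle (G : SimpleGraph V) (M : Finset (Sym2 V)) {v : V}
    (c : G.Walk v v) : Prop :=
  c.IsCycle ∧ ∀ e ∈ c.edges, ∀ f ∈ c.edges, e ≠ f →
    (∃ u : V, u ∈ e ∧ u ∈ f) → (e ∈ M ↔ f ∉ M)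

/-- `G` contains an `M`-alternating cycle. -/
def HasAlternatingCycle (G : SimpleGraph V) (M : Finset (Sym2 V)) : Prop :=
  ∃ (v : V) (c : G.Walk v v), IsAlternatingCycle G M c

/-- The cycle `c` is chordless: the subgraph induced by its vertices has no
edges other than the cycle edges. -/
def ChordlessCycle (G : SimpleGraph V) {v : V} (c : G.Walk v v) : Prop :=
  ∀ x ∈ c.support, ∀ y ∈ c.support, G.Adj x y → s(x, y) ∈ c.edges

theorem mem_closedNbhd {G : SimpleGraph V} {S : Finset V} {v : V} :
    v ∈ closedNbhd G S ↔ v ∈ S ∨ ∃ u ∈ S, G.Adj u v := by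
  simp only [closedNbhd, nbhd, Finset.mem_union, Finset.mem_filter, Finset.mem_univ, true_and]
  tauto

theorem subset_closedNbhd (G : SimpleGraph V) (S : Finset V) : S ⊆ closedNbhd G S :=
  Finset.subset_union_left

theorem closedNbhd_insert (G : SimpleGraph V) (x : V) (S : Finset V) :
    closedNbhd G (insert x S) = closedNbhd G {x} ∪ closedNbhd G S := by
  ext v
  simp only [Finset.mem_union, mem_closedNbhd, Finset.mem_insert, Finset.mem_singleton,
    exists_eq_or_imp, exists_eq_left]
  tauto

theorem IsStable.mono {W : Type*} {G : SimpleGraph W} {S T : Finset W} (hT : IsStable G T) (h : S ⊆ T) :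
    IsStable G S :=
  fun _ hx _ hy => hT (h hx) (h hy)

/-- A vertex outside `N[S]` extends a stable set `S`. -/
theorem IsStable.insert_of_notMem_closedNbhd {G : SimpleGraph V} {S : Finset V} {v : V}
    (hS : IsStable G S) (hv : v ∉ closedNbhd G S) : IsStable G (insert v S) := by
  simp only [mem_closedNbhd, not_or, not_exists, not_and] at hv
  intro a ha b hb
  rcases Finset.mem_insert.mp ha with rfl | ha' <;> rcases Finset.mem_insert.mp hb with rfl | hb'
  · exact G.irrefl
  · exact fun h => hv.2 b hb' h.symm
  · exact hv.2 a ha'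
  · exact hS ha' hb'

theorem bddAbove_card_isStable {W : Type*} (G : SimpleGraph W) (A : Finset W) :
    BddAbove {n | ∃ S ⊆ A, IsStable G S ∧ S.card = n} :=
  ⟨A.card, by rintro _ ⟨S, hS, -, rfl⟩; exact Finset.card_le_card hS⟩

theorem mem_Psi_iff {G : SimpleGraph V} {S : Finset V} :
    S ∈ Psi G ↔ IsStable G S ∧ ∀ T ⊆ closedNbhd G S, IsStable G T → T.card ≤ S.card := by
  refine and_congr_right fun hS => ⟨fun h T hT hTs => ?_, fun h => le_antisymm ?_ ?_⟩
  · rw [h]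
    exact le_csSup (bddAbove_card_isStable G _) ⟨T, hT, hTs, rfl⟩
  · exact le_csSup (bddAbove_card_isStable G _) ⟨S, subset_closedNbhd G S, hS, rfl⟩
  · refine csSup_le ⟨_, S, subset_closedNbhd G S, hS, rfl⟩ ?_
    rintro _ ⟨T, hT, hTs, rfl⟩
    exact h T hT hTs

theorem empty_mem_Psi (G : SimpleGraph V) : ∅ ∈ Psi G := by
  refine mem_Psi_iff.mpr ⟨fun x hx => absurd hx (Finset.notMem_empty x), fun T hT _ => ?_⟩
  refine Finset.card_le_card fun v hv => ?_
  simpa [mem_closedNbhd] using hT hv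

/-- If `Z, Y ∈ Ψ(G)` and `Z ⊆ N[Y]`, then `N[Z] ⊆ N[Y]`. -/
theorem closedNbhd_subset_of_mem_Psi {G : SimpleGraph V} {Y Z : Finset V} (hY : Y ∈ Psi G)
    (hZ : Z ∈ Psi G) (h : Z ⊆ closedNbhd G Y) : closedNbhd G Z ⊆ closedNbhd G Y := by
  obtain ⟨hYs, hYmax⟩ := mem_Psi_iff.mp hY
  obtain ⟨hZs, hZmax⟩ := mem_Psi_iff.mp hZ
  -- Exchanging `Y ∩ N[Z]` for `Z` inside `Y` gives a stable subset of `N[Y]`.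
  have hcard : Z.card ≤ (Y ∩ closedNbhd G Z).card := by
    have hdisj : Disjoint Z (Y \ closedNbhd G Z) :=
      Finset.disjoint_left.mpr fun v hv hv' =>
        (Finset.mem_sdiff.mp hv').2 (subset_closedNbhd G Z hv)
    have hstable : IsStable G (Z ∪ (Y \ closedNbhd G Z)) := by
      intro a ha b hb
      simp only [Finset.mem_union, Finset.mem_sdiff, mem_closedNbhd, not_or, not_exists,
        not_and] at ha hb
      rcases ha with ha | ⟨ha, -, ha'⟩ <;> rcases hb with hb | ⟨hb, -, hb'⟩
      · exact hZs ha hb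
      · exact hb' a ha
      · exact fun hab => ha' b hb hab.symm
      · exact hYs ha hb
    have hle := hYmax _ (Finset.union_subset h
      (Finset.sdiff_subset.trans (subset_closedNbhd G Y))) hstable
    rw [Finset.card_union_of_disjoint hdisj] at hle
    have := Finset.card_inter_add_card_sdiff Y (closedNbhd G Z)
    omega
  intro b hbZ
  by_contra hbY
  have hb : b ∉ Y ∩ closedNbhd G Z := fun hb =>
    hbY (subset_closedNbhd G Y (Finset.mem_inter.mp hb).1)
  have hle := hZmax (insert b (Y ∩ closedNbhd G Z))
    (Finset.insert_subset hbZ Finset.inter_subset_right)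
    ((hYs.insert_of_notMem_closedNbhd hbY).mono
      (Finset.insert_subset_insert b Finset.inter_subset_left))
  rw [Finset.card_insert_of_notMem hb] at hle
  omega

/-- If `Z`, `Z ∪ {x}` and `Y` are in `Ψ(G)`, `N[Z] ⊆ N[Y]` and `x ∉ N[Y]`,
then `Y ∪ {x} ∈ Ψ(G)`. -/
theorem insert_mem_Psi {G : SimpleGraph V} {Y Z : Finset V} {x : V} (hY : Y ∈ Psi G)
    (hZx : insert x Z ∈ Psi G) (h : closedNbhd G Z ⊆ closedNbhd G Y)
    (hx : x ∉ closedNbhd G Y) : insert x Y ∈ Psi G := by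
  obtain ⟨hYs, hYmax⟩ := mem_Psi_iff.mp hY
  obtain ⟨hZs, hZmax⟩ := mem_Psi_iff.mp hZx
  refine mem_Psi_iff.mpr ⟨hYs.insert_of_notMem_closedNbhd hx, fun T hT hTs => ?_⟩
  have hinter : (T ∩ closedNbhd G Y).card ≤ Y.card :=
    hYmax _ Finset.inter_subset_right (hTs.mono Finset.inter_subset_left)
  have hsdiff : (T \ closedNbhd G Y).card ≤ 1 := by
    rw [Finset.card_le_one]
    intro a ha b hb
    by_contra hab
    obtain ⟨haT, haY⟩ := Finset.mem_sdiff.mp ha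
    obtain ⟨hbT, hbY⟩ := Finset.mem_sdiff.mp hb
    have hmem : ∀ c ∈ T, c ∉ closedNbhd G Y → c ∈ closedNbhd G (insert x Z) := by
      intro c hc hcY
      have := hT hc
      rw [closedNbhd_insert, Finset.mem_union] at this ⊢
      exact Or.inl (this.resolve_right hcY)
    have haZ : a ∉ closedNbhd G Z := fun ha => haY (h ha)
    have hbZ : b ∉ closedNbhd G Z := fun hb => hbY (h hb)
    have hb' : b ∉ closedNbhd G (insert a Z) := by
      rw [closedNbhd_insert, Finset.mem_union]
      rintro (hba | hba)
      · rw [mem_closedNbhd] at hba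
        simp only [Finset.mem_singleton, exists_eq_left] at hba
        exact hba.elim (fun e => hab e.symm) (hTs haT hbT)
      · exact hbZ hba
    have hle := hZmax (insert b (insert a Z))
      (Finset.insert_subset (hmem b hbT hbY) (Finset.insert_subset (hmem a haT haY)
        ((Finset.subset_insert x Z).trans (subset_closedNbhd G _))))
      (((hZs.mono (Finset.subset_insert x Z)).insert_of_notMem_closedNbhd
        haZ).insert_of_notMem_closedNbhd hb')
    rw [Finset.card_insert_of_notMem fun hb => hb' (subset_closedNbhd G _ hb),
      Finset.card_insert_of_notMem fun ha => haZ (subset_closedNbhd G _ ha)] at hle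
    have := Finset.card_insert_le x Z
    omega
  have := Finset.card_inter_add_card_sdiff T (closedNbhd G Y)
  rw [Finset.card_insert_of_notMem fun hxY => hx (subset_closedNbhd G Y hxY)]
  omega

theorem AccessibleFam.exists_insert_mem_Psi {G : SimpleGraph V} (h : AccessibleFam (Psi G))
    {X Y : Finset V} (hX : X ∈ Psi G) (hY : Y ∈ Psi G) (hXY : ¬X ⊆ closedNbhd G Y) :
    ∃ x ∈ X, x ∉ Y ∧ insert x Y ∈ Psi G := by
  induction X using Finset.strongInduction with
  | H X ih =>
    have hne : X ≠ ∅ := by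
      rintro rfl
      exact hXY (Finset.empty_subset _)
    obtain ⟨x, hx, hXx⟩ := h X hX hne
    by_cases hsub : X.erase x ⊆ closedNbhd G Y
    · have hxY : x ∉ closedNbhd G Y := fun hxY =>
        hXY (Finset.insert_erase hx ▸ Finset.insert_subset hxY hsub)
      refine ⟨x, hx, fun hxY' => hxY (subset_closedNbhd G Y hxY'), ?_⟩
      exact insert_mem_Psi hY ((Finset.insert_erase hx).symm ▸ hX)
        (closedNbhd_subset_of_mem_Psi hY hXx hsub) hxY
    · obtain ⟨y, hy, hyY⟩ := ih _ (Finset.erase_ssubset hx) hXx hsub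
      exact ⟨y, Finset.mem_of_mem_erase hy, hyY⟩

/-- If `Ψ(G)` satisfies accessibility, then it satisfies exchange
and hence is a greedoid on `V(G)`. -/
theorem accessible_psi_is_greedoid (G : SimpleGraph V)
    (h : AccessibleFam (Psi G)) :
    ExchangeFam (Psi G) ∧ IsGreedoidFam (Psi G) := by
  have hex : ExchangeFam (Psi G) := by
    intro X hX Y hY hcard
    refine h.exists_insert_mem_Psi hX hY fun hsub => ?_
    have := (mem_Psi_iff.mp hY).2 X hsub (mem_Psi_iff.mp hX).1
    omega
  exact ⟨hex, ⟨∅, empty_mem_Psi G⟩, h, hex⟩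
end

section
/- A matching M in a finite simple graph G is uniquely restricted if and only if G contains no M-alternating cycle. -/
open Classical

variable {V : Type*} [Fintype V] [DecidableEq V]

/-- In a cycle, every edge at a vertex `v` is incident at `v` with another edge of the cycle. -/
theorem SimpleGraph.Walk.IsCycle.exists_ne_edge {W : Type*} {G : SimpleGraph W} {u v : W}
    {c : G.Walk u u} (hc : c.IsCycle) {e : Sym2 W} (he : e ∈ c.edges) (hv : v ∈ e) :
    ∃ f ∈ c.edges, f ≠ e ∧ v ∈ f := by
  obtain ⟨w, rfl⟩ := Sym2.mem_iff_exists.mp hv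
  have hadj : c.toSubgraph.spanningCoe.Adj v w :=
    Walk.adj_toSubgraph_iff_mem_edges.mpr he
  obtain ⟨x, ⟨hxw, hx⟩, -⟩ := hc.isCycles_spanningCoe_toSubgraph.existsUnique_ne_adj hadj
  refine ⟨s(v, x), Walk.adj_toSubgraph_iff_mem_edges.mp hx, fun h => hxw ?_,
    Sym2.mem_mk_left v x⟩
  exact (Sym2.congr_right.mp h).symm

/-- A graph with an edge all of whose nontrivial vertices have degree two contains a cycle. -/
theorem SimpleGraph.IsCycles.exists_isCycle {W : Type*} [Finite W] {H : SimpleGraph W}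
    (hH : H.IsCycles) {v w : W} (h : H.Adj v w) : ∃ (u : W) (c : H.Walk u u), c.IsCycle := by
  obtain ⟨u, c, hc, -⟩ := adj_and_reachable_delete_edges_iff_exists_cycle.mp
    ⟨h, hH.reachable_deleteEdges h⟩
  exact ⟨u, c, hc⟩

theorem mem_msupp {M : Finset (Sym2 V)} {v : V} : v ∈ msupp M ↔ MSaturates M v := by
  simp [msupp, MSaturates]

theorem IsGMatching.eq_of_mem {W : Type*} {G : SimpleGraph W} {M : Finset (Sym2 W)}
    (hM : IsGMatching G M) {e f : Sym2 W} (he : e ∈ M) (hf : f ∈ M) {v : W}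
    (hve : v ∈ e) (hvf : v ∈ f) : e = f :=
  by_contra fun hne => hM.2 e he f hf hne v hve hvf

/-- A vertex saturated by a matching has exactly one partner. -/
theorem IsGMatching.exists_partner {W : Type*} {G : SimpleGraph W} {M : Finset (Sym2 W)}
    (hM : IsGMatching G M) {v : W} (hv : MSaturates M v) :
    ∃ w, ∀ x, s(v, x) ∈ M ↔ x = w := by
  obtain ⟨e, he, hve⟩ := hv
  obtain ⟨w, rfl⟩ := Sym2.mem_iff_exists.mp hve
  refine ⟨w, fun x => ⟨fun hx => ?_, fun hx => hx ▸ he⟩⟩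
  exact Sym2.congr_right.mp (hM.eq_of_mem hx he (Sym2.mem_mk_left v x) hve)

/-- A uniquely restricted matching has no alternating cycle, since exchanging its edges along such a
cycle would give another perfect matching on the same vertices. -/
theorem UniquelyRestricted.not_hasAlternatingCycle {G : SimpleGraph V} {M : Finset (Sym2 V)}
    (hU : UniquelyRestricted G M) : ¬HasAlternatingCycle G M := by
  rintro ⟨u, c, hc, halt⟩
  have hM := hU.1
  have hswap : ∀ e ∈ c.edges, ∀ v ∈ e,
      ∃ f ∈ c.edges, f ≠ e ∧ v ∈ f ∧ (e ∈ M ↔ f ∉ M) := fun e he v hv => by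
    obtain ⟨f, hf, hne, hvf⟩ := hc.exists_ne_edge he hv
    exact ⟨f, hf, hne, hvf, halt e he f hf hne.symm ⟨v, hv, hvf⟩⟩
  let N : Finset (Sym2 V) := Finset.univ.filter fun e => ¬(e ∈ M ↔ e ∈ c.edges)
  have hN : ∀ e, e ∈ N ↔ ¬(e ∈ M ↔ e ∈ c.edges) := fun e => by simp [N]
  have hmixed : ∀ e f, e ∈ M → e ∉ c.edges → f ∈ c.edges → f ∉ M → ∀ v, v ∈ e → v ∉ f := by
    intro e f heM hec hfc hfM v hve hvf
    obtain ⟨g, hg, -, hvg, hgM⟩ := hswap f hfc v hvf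
    have hgM : g ∈ M := by tauto
    exact hec (hM.eq_of_mem heM hgM hve hvg ▸ hg)
  have hNM : N = M := by
    refine hU.2 N ⟨⟨fun e he => ?_, fun e he f hf hne v hve hvf => ?_⟩, fun e he v hve => ?_⟩
      fun v hv => ?_
    · rw [hN] at he
      by_cases heM : e ∈ M
      · exact hM.1 e heM
      · exact c.edges_subset_edgeSet (by tauto)
    · rw [hN] at he hf
      by_cases heM : e ∈ M <;> by_cases hfM : f ∈ M
      · exact hM.2 e heM f hfM hne v hve hvf
      · exact hmixed e f heM (by tauto) (by tauto) hfM v hve hvf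
      · exact hmixed f e hfM (by tauto) (by tauto) heM v hvf hve
      · have := halt e (by tauto) f (by tauto) hne ⟨v, hve, hvf⟩
        tauto
    · rw [hN] at he
      rw [mem_msupp]
      by_cases heM : e ∈ M
      · exact ⟨e, heM, hve⟩
      · obtain ⟨g, -, -, hvg, hgM⟩ := hswap e (by tauto) v hve
        exact ⟨g, by tauto, hvg⟩
    · obtain ⟨e, heM, hve⟩ := mem_msupp.mp hv
      by_cases hec : e ∈ c.edges
      · obtain ⟨g, hg, -, hvg, hgM⟩ := hswap e hec v hve
        exact ⟨g, (hN g).mpr (by tauto), hvg⟩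
      · exact ⟨e, (hN e).mpr (by tauto), hve⟩
  obtain ⟨e, he⟩ := List.exists_mem_of_ne_nil _ (mt SimpleGraph.Walk.edges_eq_nil.mp hc.not_nil)
  have := hN e
  rw [hNM] at this
  tauto

/-- Two distinct matchings with the same saturated vertices yield an alternating cycle, found in
their symmetric difference. -/
theorem IsGMatching.hasAlternatingCycle_of_ne {G : SimpleGraph V} {M N : Finset (Sym2 V)}
    (hM : IsGMatching G M) (hN : IsGMatching G N)
    (hsat : ∀ v, MSaturates M v ↔ MSaturates N v) (hne : N ≠ M) : HasAlternatingCycle G M := by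
  have hG : ∀ e, ¬(e ∈ M ↔ e ∈ N) → e ∈ G.edgeSet := fun e he => by
    by_cases heM : e ∈ M
    · exact hM.1 e heM
    · exact hN.1 e (by tauto)
  let H : SimpleGraph V := SimpleGraph.fromEdgeSet {e | ¬(e ∈ M ↔ e ∈ N)}
  have hadj : ∀ v w, H.Adj v w ↔ ¬(s(v, w) ∈ M ↔ s(v, w) ∈ N) := fun v w => by
    refine (SimpleGraph.fromEdgeSet_adj _).trans ⟨fun h => h.1, fun h => ⟨h, ?_⟩⟩
    exact (hG _ h : G.Adj v w).ne
  have hHG : H ≤ G := fun v w h => hG _ ((hadj v w).mp h)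
  have hcyc : H.IsCycles := by
    rintro v ⟨w, hw⟩
    have hv : MSaturates M v := by
      have hw := (hadj v w).mp hw
      by_cases hwM : s(v, w) ∈ M
      · exact ⟨_, hwM, Sym2.mem_mk_left v w⟩
      · exact (hsat v).mpr ⟨s(v, w), by tauto, Sym2.mem_mk_left v w⟩
    obtain ⟨a, ha⟩ := hM.exists_partner hv
    obtain ⟨b, hb⟩ := hN.exists_partner ((hsat v).mp hv)
    have hvadj : ∀ x, H.Adj v x ↔ ¬(x = a ↔ x = b) := fun x => by rw [hadj, ha, hb]
    have hab : a ≠ b := by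
      rintro rfl
      exact (hvadj w).mp hw Iff.rfl
    refine Set.ncard_eq_two.mpr ⟨a, b, hab, Set.ext fun x => (hvadj x).trans ?_⟩
    simp only [Set.mem_insert_iff, Set.mem_singleton_iff]
    grind
  obtain ⟨e, he⟩ : ∃ e, ¬(e ∈ M ↔ e ∈ N) := by
    by_contra! h
    exact hne (Finset.ext fun e => (h e).symm)
  induction e with | h a b =>
  obtain ⟨u, c, hc⟩ := hcyc.exists_isCycle ((hadj a b).mpr he)
  have hmem : ∀ e ∈ (c.mapLe hHG).edges, ¬(e ∈ M ↔ e ∈ N) := fun e he => by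
    rw [SimpleGraph.Walk.edges_mapLe_eq_edges] at he
    induction e with | h x y =>
    exact (hadj x y).mp (c.adj_of_mem_edges he)
  refine ⟨u, c.mapLe hHG, hc.mapLe hHG, fun e he f hf hef ⟨v, hve, hvf⟩ => ?_⟩
  have hNe := hmem e he
  have hNf := hmem f hf
  have hMef : ¬(e ∈ M ∧ f ∈ M) := fun h => hef (hM.eq_of_mem h.1 h.2 hve hvf)
  have hNef : ¬(e ∈ N ∧ f ∈ N) := fun h => hef (hN.eq_of_mem h.1 h.2 hve hvf)
  tauto

/-- A matching `M` of `G` is uniquely restricted iff `G` contains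
no `M`-alternating cycle. -/
theorem uniquely_restricted_iff_no_alternating_cycle (G : SimpleGraph V)
    (M : Finset (Sym2 V)) (hM : IsGMatching G M) :
    UniquelyRestricted G M ↔ ¬HasAlternatingCycle G M := by
  refine ⟨UniquelyRestricted.not_hasAlternatingCycle, fun h => ⟨hM, fun N hN hsat => ?_⟩⟩
  by_contra hne
  refine h (hM.hasAlternatingCycle_of_ne hN.1 (fun v => ?_) hne)
  exact ⟨fun hv => hsat v (mem_msupp.mpr hv),
    fun ⟨e, he, hve⟩ => mem_msupp.mp (hN.2 e he v hve)⟩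
end

section
/- Let G be a finite simple König-Egerváry graph. Then for every maximum matching M of G and every maximum stable set S of G, each edge of M has exactly one endpoint in S (that is, M is contained in the set of edges joining S to V(G)−S). -/
open Classical

variable {V : Type*} [Fintype V] [DecidableEq V]

/-- A matching with at least as many edges as there are vertices outside a stable set `S`
has no edge avoiding `S`. -/
theorem IsGMatching.exists_mem_of_card_compl_le {G : SimpleGraph V} {M : Finset (Sym2 V)}
    {S : Finset V} (hM : IsGMatching G M) (hS : IsStable G S) (hcard : Sᶜ.card ≤ M.card)
    {e : Sym2 V} (he : e ∈ M) : ∃ x ∈ e, x ∈ S := by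
  have hout : ∀ e ∈ M, ∃ v ∈ e, v ∉ S := by
    intro e he
    induction e using Sym2.ind with
    | _ x y =>
      have hadj : G.Adj x y := hM.1 _ he
      by_cases hx : x ∈ S
      · exact ⟨y, Sym2.mem_mk_right x y, fun hy => hS hx hy hadj⟩
      · exact ⟨x, Sym2.mem_mk_left x y, hx⟩
  have : Nonempty V := ⟨e.out.1⟩
  choose! f hf hfS using hout
  have hinj : Set.InjOn f (M : Set (Sym2 V)) := by
    intro a ha b hb hab
    by_contra hne
    exact hM.2 a ha b hb hne (f a) (hf a ha) (hab ▸ hf b hb)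
  have hmaps : Set.MapsTo f (M : Set (Sym2 V)) (Sᶜ : Finset V) := fun a ha => Finset.mem_compl.2 (hfS a ha)
  have hsurj : ∀ v ∉ S, ∃ a ∈ M, f a = v := fun v hv =>
    Finset.surjOn_of_injOn_of_card_le f hmaps hinj hcard (Finset.mem_compl.2 hv)
  by_contra! hno
  have honly : ∀ v ∈ e, f e = v := by
    intro v hv
    obtain ⟨a, ha, rfl⟩ := hsurj v (hno v hv)
    by_contra hne
    exact hM.2 a ha e he (fun h => hne (h ▸ rfl)) (f a) (hf a ha) hv
  induction e using Sym2.ind with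
  | _ x y =>
    have hadj : G.Adj x y := hM.1 _ he
    exact hadj.ne ((honly x (Sym2.mem_mk_left x y)).symm.trans (honly y (Sym2.mem_mk_right x y)))

/-- In a König-Egerváry graph, every edge of a maximum matching
has exactly one endpoint in every maximum stable set. -/
theorem ke_max_matching_crosses_max_stable (G : SimpleGraph V)
    (hKE : KonigEgervary G) (M : Finset (Sym2 V))
    (hM : IsMaximumGMatching G M) (S : Finset V)
    (hS : IsStable G S) (hSmax : S.card = alpha G) :
    ∀ e ∈ M, ∃ x y : V, e = s(x, y) ∧ x ∈ S ∧ y ∉ S := by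
  intro e he
  have hcard : Sᶜ.card ≤ M.card := by
    rw [Finset.card_compl, hM.2, hSmax, ← hKE]
    omega
  obtain ⟨x, hxe, hxS⟩ := hM.1.exists_mem_of_card_compl_le hS hcard he
  obtain ⟨y, rfl⟩ := hxe
  have hadj : G.Adj x y := hM.1.1 _ he
  exact ⟨x, y, rfl, hxS, fun hy => hS hxS hy hadj⟩
end

section
/- Let G be a finite simple König-Egerváry graph. Then every α-critical edge of G is also μ-critical, i.e., if e is an edge with α(G − e) > α(G), then μ(G − e) < μ(G). -/
open Classical

variable {V : Type*} [Fintype V] [DecidableEq V]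

theorem exists_isStable_card_eq_alpha {V : Type*} [Fintype V] (G : SimpleGraph V) :
    ∃ S : Finset V, IsStable G S ∧ S.card = alpha G := by
  have h : alpha G ∈ {n | ∃ S ⊆ (Finset.univ : Finset V), IsStable G S ∧ S.card = n} := by
    refine Nat.sSup_mem ⟨0, ∅, by simp, by simp [IsStable], by simp⟩ ⟨Fintype.card V, ?_⟩
    rintro _ ⟨S, -, -, rfl⟩
    exact S.card_le_univ
  obtain ⟨S, -, hS⟩ := h
  exact ⟨S, hS⟩

theorem exists_isGMatching_card_eq_mu {V : Type*} [Fintype V] (G : SimpleGraph V) :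
    ∃ M : Finset (Sym2 V), IsGMatching G M ∧ M.card = mu G := by
  have h : mu G ∈ {n | ∃ M, IsGMatchingOn G Finset.univ M ∧ M.card = n} := by
    refine Nat.sSup_mem ⟨0, ∅, by simp [IsGMatchingOn, IsGMatching], by simp⟩
      ⟨Fintype.card (Sym2 V), ?_⟩
    rintro _ ⟨M, -, rfl⟩
    exact M.card_le_univ
  obtain ⟨M, hM, hcard⟩ := h
  exact ⟨M, hM.1, hcard⟩

theorem IsStable.exists_mem_notMem {V : Type*} {G : SimpleGraph V} {S : Finset V}
    (hS : IsStable G S) (e : Sym2 V) : ∃ v ∈ e, e ∈ G.edgeSet → v ∉ S := by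
  induction e with
  | h x y =>
    by_cases hx : x ∈ S
    · exact ⟨y, Sym2.mem_mk_right x y, fun he hy => hS hx hy he⟩
    · exact ⟨x, Sym2.mem_mk_left x y, fun _ => hx⟩

/-- Every edge of a matching has an endpoint outside a given stable set, and these endpoints
are distinct. -/
theorem IsStable.card_add_card_le {G : SimpleGraph V} {S : Finset V} {M : Finset (Sym2 V)}
    (hS : IsStable G S) (hM : IsGMatching G M) : S.card + M.card ≤ Fintype.card V := by
  choose f hfe hfS using hS.exists_mem_notMem
  have hle : M.card ≤ Sᶜ.card := by
    refine Finset.card_le_card_of_injOn f (fun e he => by simpa using hfS e (hM.1 e he)) ?_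
    intro e he e' he' hee'
    by_contra hne
    exact hM.2 e he e' he' hne (f e) (hfe e) (hee' ▸ hfe e')
  have hcompl := S.card_add_card_compl
  omega

theorem alpha_add_mu_le_card (G : SimpleGraph V) : alpha G + mu G ≤ Fintype.card V := by
  obtain ⟨S, hS, hScard⟩ := exists_isStable_card_eq_alpha G
  obtain ⟨M, hM, hMcard⟩ := exists_isGMatching_card_eq_mu G
  exact hScard ▸ hMcard ▸ hS.card_add_card_le hM

/-- In a König-Egerváry graph every α-critical edge is also
μ-critical. -/
theorem ke_alpha_critical_is_mu_critical (G : SimpleGraph V)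
    (hKE : KonigEgervary G) (e : Sym2 V) (he : e ∈ G.edgeSet)
    (ha : alpha G < alpha (G.deleteEdges {e})) :
    mu (G.deleteEdges {e}) < mu G := by
  have hle := alpha_add_mu_le_card (G.deleteEdges {e})
  unfold KonigEgervary at hKE
  omega
end

section
/- Let G be a finite simple graph without isolated vertices. Then the following are equivalent: (i) G is very well-covered; (ii) there exists a perfect matching M in G satisfying property P, namely: for every edge xy ∈ M, N(x) ∩ N(y) = ∅ and every vertex v ∈ N(x) − {y} is adjacent to every vertex of N(y) − {x}; (iii) G has at least one perfect matching and every perfect matching of G satisfies property P. -/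
open Classical

variable {V : Type*} [Fintype V] [DecidableEq V]

/-- Property `P` of a matching: for every edge `xy ∈ M`, `N(x) ∩ N(y) = ∅` and
each `v ∈ N(x) - {y}` is adjacent to all vertices of `N(y) - {x}`. -/
def PropertyP (G : SimpleGraph V) (M : Finset (Sym2 V)) : Prop :=
  ∀ x y : V, s(x, y) ∈ M →
    (∀ v : V, ¬(G.Adj x v ∧ G.Adj y v)) ∧
      ∀ v : V, G.Adj x v → v ≠ y → ∀ u : V, G.Adj y u → u ≠ x → G.Adj v u

set_option linter.unusedSectionVars false in
theorem IsStable.exists_isMaximalStable_superset {G : SimpleGraph V} {S : Finset V}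
    (hS : IsStable G S) : ∃ T, IsMaximalStable G T ∧ S ⊆ T := by
  obtain ⟨T, hST, hT⟩ := (Set.toFinite {T | IsStable G T}).exists_le_maximal hS
  exact ⟨T, ⟨hT.prop, fun U hU hTU => le_antisymm hTU (hT.le_of_ge hU hTU)⟩, hST⟩

set_option linter.unusedSectionVars false in
theorem bddAbove_stable_card (G : SimpleGraph V) :
    BddAbove {n | ∃ S ⊆ Finset.univ, IsStable G S ∧ S.card = n} :=
  ⟨Fintype.card V, by rintro n ⟨S, -, -, rfl⟩; exact S.card_le_univ⟩

theorem IsStable.card_le_alpha {G : SimpleGraph V} {S : Finset V} (hS : IsStable G S) :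
    S.card ≤ alpha G :=
  le_csSup (bddAbove_stable_card G) ⟨S, S.subset_univ, hS, rfl⟩

theorem exists_isMaximalStable_card_eq_alpha (G : SimpleGraph V) :
    ∃ S, IsMaximalStable G S ∧ S.card = alpha G := by
  obtain ⟨S, -, hS, hcard⟩ := Nat.sSup_mem
    (s := {n | ∃ S ⊆ Finset.univ, IsStable G S ∧ S.card = n})
    ⟨0, ∅, by simp, by simp [IsStable], rfl⟩ (bddAbove_stable_card G)
  obtain ⟨T, hT, hST⟩ := hS.exists_isMaximalStable_superset
  exact ⟨T, hT, le_antisymm hT.1.card_le_alpha (hcard.symm.trans_le (Finset.card_le_card hST))⟩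

theorem VeryWellCovered.two_mul_card {G : SimpleGraph V} (hG : VeryWellCovered G)
    {S : Finset V} (hS : IsMaximalStable G S) : 2 * S.card = Fintype.card V := by
  obtain ⟨T, hT, hcard⟩ := exists_isMaximalStable_card_eq_alpha G
  rw [hG.1 S T hS hT, hcard, hG.2.2]

/-- In a well-covered graph a stable set is no larger than the part of any maximal stable set
inside its closed neighborhood. -/
theorem WellCovered.card_le_card_inter_add {G : SimpleGraph V} (hG : WellCovered G)
    {A S : Finset V} (hA : IsStable G A) (hS : IsMaximalStable G S) :
    A.card ≤ (S ∩ nbhd G A).card + (S ∩ A).card := by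
  have hstable : IsStable G ((S \ nbhd G A) ∪ A) := by
    intro x hx y hy hxy
    have h₁ := @hA x
    have h₂ := @hS.1 x
    have h₃ := hxy.symm
    simp only [Finset.mem_union, Finset.mem_sdiff, nbhd, Finset.mem_filter,
      Finset.mem_univ, true_and] at hx hy
    grind
  obtain ⟨T, hT, hsub⟩ := hstable.exists_isMaximalStable_superset
  have hle := Finset.card_le_card hsub
  rw [hG T S hT hS] at hle
  have hunion := Finset.card_union_add_card_inter (S \ nbhd G A) A
  have hsplit := Finset.card_sdiff_add_card_inter S (nbhd G A)
  have hinter : ((S \ nbhd G A) ∩ A).card ≤ (S ∩ A).card :=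
    Finset.card_le_card (Finset.inter_subset_inter_right Finset.sdiff_subset)
  omega

theorem WellCovered.card_le_card_nbhd {G : SimpleGraph V} (hG : WellCovered G)
    (h : ∀ v : V, ∃ u, G.Adj v u) (A : Finset V) (hA : IsStable G A) :
    A.card ≤ (nbhd G A).card := by
  induction A using Finset.strongInduction with
  | H A ih =>
    obtain rfl | ⟨a, ha⟩ := A.eq_empty_or_nonempty
    · simp
    obtain ⟨b, hab⟩ := h a
    obtain ⟨S, hS, hbS⟩ := (show IsStable G {b} by simp [IsStable]).exists_isMaximalStable_superset
    rw [Finset.singleton_subset_iff] at hbS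
    have hss : S ∩ A ⊂ A :=
      Finset.ssubset_iff_subset_ne.2 ⟨Finset.inter_subset_right, fun heq =>
        hS.1 (Finset.mem_inter.1 (heq.symm ▸ ha)).1 hbS hab⟩
    have hsmall := ih _ hss fun x hx y hy =>
      hA (Finset.mem_inter.1 hx).2 (Finset.mem_inter.1 hy).2
    have hsub : nbhd G (S ∩ A) ⊆ nbhd G A \ S := by
      intro v hv
      simp only [nbhd, Finset.mem_filter, Finset.mem_univ, true_and, Finset.mem_inter,
        Finset.mem_sdiff] at hv ⊢
      obtain ⟨-, u, ⟨huS, huA⟩, huv⟩ := hv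
      exact ⟨⟨fun hvA => hA huA hvA huv, u, huA, huv⟩, fun hvS => hS.1 huS hvS huv⟩
    have hle := Finset.card_le_card hsub
    have hsplit := Finset.card_sdiff_add_card_inter (nbhd G A) S
    rw [Finset.inter_comm] at hsplit
    have hkey := hG.card_le_card_inter_add hA hS
    omega

theorem VeryWellCovered.exists_isPerfectGMatching {G : SimpleGraph V} (hG : VeryWellCovered G) :
    ∃ M : Finset (Sym2 V), IsPerfectGMatching G M := by
  obtain ⟨S, hS, -⟩ := exists_isMaximalStable_card_eq_alpha G
  have hcard := hG.two_mul_card hS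
  have hHall := (Fintype.all_card_le_filter_rel_iff_exists_injective
    (fun (s : S) (v : V) => G.Adj s v)).1 fun A => by
      have hA : IsStable G (A.map (Function.Embedding.subtype _)) := by
        intro x hx y hy
        simp only [Finset.mem_map, Function.Embedding.subtype_apply] at hx hy
        obtain ⟨x, -, rfl⟩ := hx
        obtain ⟨y, -, rfl⟩ := hy
        exact hS.1 x.2 y.2
      have hle := hG.1.card_le_card_nbhd hG.2.1 _ hA
      rw [Finset.card_map] at hle
      refine hle.trans (Finset.card_le_card fun v hv => ?_)
      simp only [nbhd, Finset.mem_filter, Finset.mem_map, Finset.mem_univ, true_and,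
        Function.Embedding.subtype_apply] at hv ⊢
      obtain ⟨-, _, ⟨s, hs, rfl⟩, hadj⟩ := hv
      exact ⟨s, hs, hadj⟩
  obtain ⟨f, hinj, hadj⟩ := hHall
  have hfS : ∀ s, f s ∉ S := fun s hs => hS.1 s.2 hs (hadj s)
  have himage : Finset.univ.image f = Sᶜ := by
    refine Finset.eq_of_subset_of_card_le (fun v hv => ?_) ?_
    · obtain ⟨s, -, rfl⟩ := Finset.mem_image.1 hv
      exact Finset.mem_compl.2 (hfS s)
    · rw [Finset.card_image_of_injective _ hinj, Finset.card_compl, Finset.card_univ,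
        Fintype.card_coe]
      omega
  refine ⟨Finset.univ.image fun s : S => s(s.1, f s), ⟨?_, ?_⟩, fun v => ?_⟩
  · intro e he
    obtain ⟨s, -, rfl⟩ := Finset.mem_image.1 he
    exact hadj s
  · intro e he e' he' hne v hv hv'
    obtain ⟨s, -, rfl⟩ := Finset.mem_image.1 he
    obtain ⟨t, -, rfl⟩ := Finset.mem_image.1 he'
    have hst : s ≠ t := by rintro rfl; exact hne rfl
    rcases Sym2.mem_iff.1 hv with rfl | rfl <;> rcases Sym2.mem_iff.1 hv' with heq | heq
    · exact hst (Subtype.ext heq)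
    · exact hfS t (heq ▸ s.2)
    · exact hfS s (heq ▸ t.2)
    · exact hst (hinj heq)
  · by_cases hv : v ∈ S
    · exact ⟨_, Finset.mem_image_of_mem _ (Finset.mem_univ ⟨v, hv⟩), Sym2.mem_mk_left _ _⟩
    · obtain ⟨s, -, rfl⟩ := Finset.mem_image.1 (himage.symm ▸ Finset.mem_compl.2 hv)
      exact ⟨_, Finset.mem_image_of_mem _ (Finset.mem_univ s), Sym2.mem_mk_right _ _⟩

set_option linter.unusedSectionVars false in
/-- A perfect matching is given by the involution exchanging the ends of its edges. -/
theorem IsPerfectGMatching.exists_involutive {G : SimpleGraph V} {M : Finset (Sym2 V)}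
    (hM : IsPerfectGMatching G M) :
    ∃ f : V → V, Function.Involutive f ∧ (∀ v, G.Adj v (f v)) ∧
      ∀ x y, s(x, y) ∈ M ↔ f x = y := by
  have hex : ∀ v, ∃ w, s(v, w) ∈ M := fun v => by
    obtain ⟨e, he, w, rfl⟩ := hM.2 v
    exact ⟨w, he⟩
  choose f hf using hex
  have huniq : ∀ x y, s(x, y) ∈ M → f x = y := fun x y hxy => by
    by_contra hne
    exact hM.1.2 _ (hf x) _ hxy (fun heq => hne (Sym2.congr_right.1 heq)) x
      (Sym2.mem_mk_left _ _) (Sym2.mem_mk_left _ _)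
  exact ⟨f, fun v => huniq _ _ (Sym2.eq_swap ▸ hf v), fun v => hM.1.1 _ (hf v),
    fun x y => ⟨huniq x y, fun hxy => hxy ▸ hf x⟩⟩

/-- Given a perfect matching, a stable set has at most half of the vertices, with equality
exactly when it meets every matching edge. -/
theorem IsStable.two_mul_card_eq_iff {G : SimpleGraph V} {f : V → V}
    (hf : Function.Involutive f) (hadj : ∀ v, G.Adj v (f v)) {S : Finset V}
    (hS : IsStable G S) :
    2 * S.card = Fintype.card V ↔ ∀ v, v ∈ S ∨ f v ∈ S := by
  have hsub : S.image f ⊆ Sᶜ := fun v hv => by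
    obtain ⟨s, hs, rfl⟩ := Finset.mem_image.1 hv
    exact Finset.mem_compl.2 fun hfs => hS hs hfs (hadj s)
  have himage : (S.image f).card = S.card := Finset.card_image_of_injective _ hf.injective
  have hcompl := S.card_add_card_compl
  constructor
  · intro hcard v
    have heq := Finset.eq_of_subset_of_card_le hsub (by omega)
    by_cases hv : v ∈ S
    · exact .inl hv
    · obtain ⟨s, hs, rfl⟩ := Finset.mem_image.1 (heq.symm ▸ Finset.mem_compl.2 hv)
      exact .inr ((hf s).symm ▸ hs)
  · intro hmeet
    have heq : S.image f = Sᶜ := hsub.antisymm fun v hv =>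
      Finset.mem_image.2 ⟨f v, (hmeet v).resolve_left (Finset.mem_compl.1 hv), hf v⟩
    rw [heq] at himage
    omega

set_option linter.unusedSectionVars false in
theorem IsMaximalStable.exists_adj {G : SimpleGraph V} {S : Finset V}
    (hS : IsMaximalStable G S) {v : V} (hv : v ∉ S) : ∃ u ∈ S, G.Adj v u := by
  by_contra! hno
  have hstable : IsStable G (insert v S) := by
    intro x hx y hy hxy
    rw [Finset.mem_insert] at hx hy
    obtain rfl | hx := hx <;> obtain rfl | hy := hy
    · exact G.loopless.irrefl _ hxy
    · exact hno y hy hxy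
    · exact hno x hx hxy.symm
    · exact hS.1 hx hy hxy
  exact hv (hS.2 _ hstable (Finset.subset_insert v S) ▸ Finset.mem_insert_self v S)

theorem PropertyP.veryWellCovered {G : SimpleGraph V} (h : ∀ v : V, ∃ u, G.Adj v u)
    {M : Finset (Sym2 V)} (hM : IsPerfectGMatching G M) (hP : PropertyP G M) :
    VeryWellCovered G := by
  obtain ⟨f, hf, hadj, hfM⟩ := hM.exists_involutive
  have hhalf : ∀ S, IsMaximalStable G S → 2 * S.card = Fintype.card V := by
    intro S hS
    refine (hS.1.two_mul_card_eq_iff hf hadj).2 fun x => ?_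
    by_contra! hx
    obtain ⟨v, hv, hxv⟩ := hS.exists_adj hx.1
    obtain ⟨u, hu, hyu⟩ := hS.exists_adj hx.2
    exact hS.1 hv hu ((hP x (f x) ((hfM _ _).2 rfl)).2 v hxv
      (fun heq => hx.2 (heq ▸ hv)) u hyu fun heq => hx.1 (heq ▸ hu))
  refine ⟨fun S T hS hT => ?_, h, ?_⟩
  · have hS' := hhalf S hS
    have hT' := hhalf T hT
    omega
  · obtain ⟨S, hS, hcard⟩ := exists_isMaximalStable_card_eq_alpha G
    rw [← hcard, hhalf S hS]

theorem VeryWellCovered.propertyP {G : SimpleGraph V} (hG : VeryWellCovered G)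
    {M : Finset (Sym2 V)} (hM : IsPerfectGMatching G M) : PropertyP G M := by
  obtain ⟨f, hf, hadj, hfM⟩ := hM.exists_involutive
  have hkey : ∀ x v u, G.Adj x v → G.Adj (f x) u → G.Adj v u := by
    intro x v u hxv hyu
    by_contra hvu
    have hstable : IsStable G {v, u} := by
      have huv : ¬G.Adj u v := fun huv => hvu huv.symm
      simp [IsStable, hvu, huv]
    obtain ⟨S, hS, hsub⟩ := hstable.exists_isMaximalStable_superset
    have hvS : v ∈ S := hsub (by simp)
    have huS : u ∈ S := hsub (by simp)
    rcases (hS.1.two_mul_card_eq_iff hf hadj).1 (hG.two_mul_card hS) x with hx | hx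
    · exact hS.1 hx hvS hxv
    · exact hS.1 hx huS hyu
  intro x y hxy
  obtain rfl := (hfM x y).1 hxy
  exact ⟨fun v hv => G.loopless.irrefl v (hkey x v v hv.1 hv.2),
    fun v hxv _ u hyu _ => hkey x v u hxv hyu⟩

/-- For a graph `G` without isolated vertices the following are
equivalent: (i) `G` is very well-covered; (ii) some perfect matching of `G`
satisfies property `P`; (iii) `G` has a perfect matching and every perfect
matching of `G` satisfies property `P`. -/
theorem vwc_tfae_property_p (G : SimpleGraph V)
    (h : ∀ v : V, ∃ u, G.Adj v u) :
    List.TFAE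
      [ VeryWellCovered G,
        ∃ M : Finset (Sym2 V), IsPerfectGMatching G M ∧ PropertyP G M,
        (∃ M : Finset (Sym2 V), IsPerfectGMatching G M) ∧
          ∀ M : Finset (Sym2 V), IsPerfectGMatching G M → PropertyP G M ] := by
  tfae_have 1 → 3 := fun hG => ⟨hG.exists_isPerfectGMatching, fun M hM => hG.propertyP hM⟩
  tfae_have 3 → 2 := fun ⟨⟨M, hM⟩, hP⟩ => ⟨M, hM, hP M hM⟩
  tfae_have 2 → 1 := fun ⟨_, hM, hP⟩ => hP.veryWellCovered h hM
  tfae_finish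
end
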